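/- arXiv:2511.20413 — 3 statements merged into one kernel-verified Lean document; each statement's English description precedes it below -/
import Mathlib

section
/- Let Θ be a measurable space, π₀ a probability measure on Θ (the prior), Z a measurable space, μ a probability measure on Z, and ℓ : Θ × Z → ℝ a measurable loss function with values in [0, C] for some C > 0. For n i.i.d. samples z₁, …, zₙ from μ, define the true risk R(θ) = ∫ ℓ(θ, z) dμ(z) and the empirical risk r(θ) = (1/n) Σᵢ ℓ(θ, zᵢ). Then for any λ > 0 and any δ ∈ (0,1), with probability at least 1 − δ over the draw of the sample, simultaneously for every probability measure π on Θ with π absolutely continuous with respect to π₀, one has ∫ R dπ ≤ ∫ r dπ + λC²/(8n) + (KL(π ‖ π₀) + log(1/δ))/λ, where KL(π ‖ π₀) denotes the Kullback–Leibler divergence of π from π₀. -/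
open MeasureTheory Classical

/-- Kullback–Leibler divergence `∫ log (dπ/dπ₀) dπ`, taken to be `+∞` if `π` is not
absolutely continuous with respect to `π₀` (or if the log-density is not integrable). -/
noncomputable def KL {Θ : Type*} [MeasurableSpace Θ] (π π₀ : Measure Θ) : EReal :=
  if π ≪ π₀ ∧ Integrable (fun θ => Real.log ((π.rnDeriv π₀ θ).toReal)) π
  then ((∫ θ, Real.log ((π.rnDeriv π₀ θ).toReal) ∂π : ℝ) : EReal)
  else ⊤

open ProbabilityTheory

/-- The Donsker–Varadhan inequality. -/
theorem integral_le_integral_llr_add_log_integral_exp {Θ : Type*} [MeasurableSpace Θ]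
    {π π₀ : Measure Θ} [IsProbabilityMeasure π] [IsProbabilityMeasure π₀] {f : Θ → ℝ}
    (hac : π ≪ π₀) (hf : Integrable f π) (hexp : Integrable (fun θ => Real.exp (f θ)) π₀)
    (hllr : Integrable (llr π π₀) π) :
    ∫ θ, f θ ∂π ≤ ∫ θ, llr π π₀ θ ∂π + Real.log (∫ θ, Real.exp (f θ) ∂π₀) := by
  have := isProbabilityMeasure_tilted hexp
  have h := InformationTheory.integral_llr_add_sub_measure_univ_nonneg
    (hac.trans (absolutelyContinuous_tilted hexp))
    (integrable_llr_tilted_right hac hf hllr hexp)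
  rw [integral_llr_tilted_right hac hf hexp hllr] at h
  simp only [probReal_univ] at h
  linarith

/-- Hoeffding's bound on the exponential moments of the gap between mean and empirical mean. -/
theorem integral_exp_mul_integral_sub_average_le {Z : Type*} [MeasurableSpace Z]
    (μ : Measure Z) [IsProbabilityMeasure μ] {X : Z → ℝ} (hX : Measurable X) {a b : ℝ}
    (hab : ∀ z, X z ∈ Set.Icc a b) {n : ℕ} (hn : 0 < n) (t : ℝ) :
    ∫ zs, Real.exp (t * (∫ z, X z ∂μ - (n : ℝ)⁻¹ * ∑ i, X (zs i)))
        ∂(Measure.pi fun _ : Fin n => μ)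
      ≤ Real.exp (t ^ 2 * (b - a) ^ 2 / (8 * n)) := by
  have hsub := hasSubgaussianMGF_of_mem_Icc hX.aemeasurable (ae_of_all μ hab)
  have hsum := HasSubgaussianMGF.sum_of_iIndepFun (s := Finset.univ)
    (iIndepFun_pi (μ := fun _ : Fin n => μ) (X := fun _ z => X z - ∫ z, X z ∂μ)
      fun _ => (hX.sub_const _).aemeasurable)
    (c := fun _ => (‖b - a‖₊ / 2) ^ 2) fun i _ =>
      .of_map (X := fun z => X z - ∫ z, X z ∂μ) (Y := fun zs : Fin n → Z => zs i)
        (measurable_pi_apply i).aemeasurable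
        (by rwa [(measurePreserving_eval (fun _ : Fin n => μ) i).map_eq])
  have hn' : (n : ℝ) ≠ 0 := by positivity
  convert! hsum.mgf_le (-(t / n)) using 1
  · refine integral_congr_ae (ae_of_all _ fun zs => ?_)
    simp only [Finset.sum_sub_distrib, Finset.sum_const, Finset.card_univ, Fintype.card_fin,
      nsmul_eq_mul]
    congr 1
    field_simp
    ring
  · congr 1
    simp only [Finset.sum_const, Finset.card_univ, Fintype.card_fin, nsmul_eq_mul]
    push_cast
    rw [div_pow, Real.norm_eq_abs, sq_abs]
    field_simp
    ring

/-- Markov's inequality for the complementary event. -/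
theorem ofReal_one_sub_le_measure_lt {Ω : Type*} [MeasurableSpace Ω] {P : Measure Ω}
    [IsProbabilityMeasure P] {V : Ω → ℝ} (hV : Measurable V) (hV0 : ∀ ω, 0 ≤ V ω)
    (hint : Integrable V P) {M δ : ℝ} (hM : 0 < M) (hδ : 0 < δ) (hle : ∫ ω, V ω ∂P ≤ M) :
    ENNReal.ofReal (1 - δ) ≤ P {ω | V ω < M / δ} := by
  have h := (mul_meas_ge_le_integral_of_nonneg (ae_of_all P hV0) hint (M / δ)).trans hle
  have hc : {ω | V ω < M / δ} = {ω | M / δ ≤ V ω}ᶜ := by ext; simp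
  rw [← ofReal_measureReal, hc, probReal_compl_eq_one_sub (measurableSet_le measurable_const hV)]
  refine ENNReal.ofReal_le_ofReal (sub_le_sub_left ?_ 1)
  rw [div_mul_eq_mul_div, div_le_iff₀ hδ] at h
  exact le_of_mul_le_mul_left h hM

/-- Classical PAC-Bayes bound for bounded losses (Alquier, Theorem 2.1). -/
theorem pac_bayes_bounded_loss
    {Θ Z : Type*} [MeasurableSpace Θ] [MeasurableSpace Z]
    (π₀ : Measure Θ) [IsProbabilityMeasure π₀]
    (μ : Measure Z) [IsProbabilityMeasure μ]
    (ℓ : Θ → Z → ℝ) (hℓ : Measurable (Function.uncurry ℓ))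
    (C : ℝ) (hC : 0 < C) (hbound : ∀ θ z, ℓ θ z ∈ Set.Icc (0 : ℝ) C)
    (n : ℕ) (hn : 0 < n)
    (lam : ℝ) (hlam : 0 < lam) (δ : ℝ) (hδ : δ ∈ Set.Ioo (0 : ℝ) 1) :
    ENNReal.ofReal (1 - δ) ≤
      (Measure.pi fun _ : Fin n => μ)
        {zs | ∀ π : Measure Θ, IsProbabilityMeasure π → π ≪ π₀ →
          ((∫ θ, ∫ z, ℓ θ z ∂μ ∂π : ℝ) : EReal) ≤
            ((∫ θ, (n : ℝ)⁻¹ * ∑ i, ℓ θ (zs i) ∂π : ℝ) : EReal)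
            + ((lam * C ^ 2 / (8 * n) : ℝ) : EReal)
            + (KL π π₀ + ((Real.log (1 / δ) : ℝ) : EReal)) / ((lam : ℝ) : EReal)} := by
  obtain ⟨hδ0, -⟩ := hδ
  have hn' : (0 : ℝ) < n := by exact_mod_cast hn
  have hℓθ (θ : Θ) : Measurable (ℓ θ) := hℓ.of_uncurry_left
  set R : Θ → ℝ := fun θ => ∫ z, ℓ θ z ∂μ
  set r : Θ → (Fin n → Z) → ℝ := fun θ zs => (n : ℝ)⁻¹ * ∑ i, ℓ θ (zs i)
  have hRm : Measurable R := hℓ.stronglyMeasurable.integral_prod_right.measurable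
  have hrm : Measurable (Function.uncurry r) := by
    refine (Finset.measurable_sum _ fun i _ => ?_).const_mul _
    exact hℓ.comp (measurable_fst.prodMk ((measurable_pi_apply i).comp measurable_snd))
  have hRb (θ : Θ) : R θ ∈ Set.Icc 0 C := by
    refine ⟨integral_nonneg fun z => (hbound θ z).1, ?_⟩
    simpa using integral_mono
      (.of_mem_Icc 0 C (hℓθ θ).aemeasurable (ae_of_all μ (hbound θ))) (integrable_const C)
      fun z => (hbound θ z).2
  have hrb (θ : Θ) (zs : Fin n → Z) : r θ zs ∈ Set.Icc 0 C := by
    refine ⟨mul_nonneg (by positivity) (Finset.sum_nonneg fun i _ => (hbound θ _).1), ?_⟩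
    have h : ∑ i, ℓ θ (zs i) ≤ n * C := by
      simpa using Finset.sum_le_sum fun i (_ : i ∈ Finset.univ) => (hbound θ (zs i)).2
    exact (inv_mul_le_iff₀ hn').2 h
  set E : (Fin n → Z) → Θ → ℝ := fun zs θ => Real.exp (lam * (R θ - r θ zs))
  have hEm : Measurable (Function.uncurry E) :=
    (((hRm.comp measurable_snd).sub (hrm.comp measurable_swap)).const_mul lam).exp
  have hEb (zs : Fin n → Z) (θ : Θ) : E zs θ ∈ Set.Icc 0 (Real.exp (lam * C)) := by
    refine ⟨(Real.exp_pos _).le, Real.exp_le_exp.2 (mul_le_mul_of_nonneg_left ?_ hlam.le)⟩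
    linarith [(hRb θ).2, (hrb θ zs).1]
  set M := Real.exp (lam ^ 2 * C ^ 2 / (8 * n))
  have hEint : Integrable (Function.uncurry E) ((Measure.pi fun _ : Fin n => μ).prod π₀) :=
    .of_mem_Icc _ _ hEm.aemeasurable (ae_of_all _ fun p => hEb p.1 p.2)
  have hmean : ∫ zs, ∫ θ, E zs θ ∂π₀ ∂(Measure.pi fun _ : Fin n => μ) ≤ M := by
    rw [integral_integral_swap hEint]
    simpa using integral_mono hEint.integral_prod_right (integrable_const M) fun θ => by
      simpa using integral_exp_mul_integral_sub_average_le μ (hℓθ θ) (hbound θ) hn lam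
  refine (ofReal_one_sub_le_measure_lt
    hEm.stronglyMeasurable.integral_prod_right.measurable
    (fun zs => integral_nonneg fun θ => (hEb zs θ).1) hEint.integral_prod_left
    (Real.exp_pos _) hδ0 hmean).trans (measure_mono fun zs hzs π _ hac => ?_)
  by_cases hllr : Integrable (llr π π₀) π
  swap
  · rw [KL, if_neg fun h => hllr h.2, EReal.top_add_coe,
      EReal.top_div_of_pos_ne_top (EReal.coe_pos.2 hlam) (EReal.coe_ne_top _),
      ← EReal.coe_add, EReal.coe_add_top]
    exact le_top
  have hRint : Integrable R π := .of_mem_Icc 0 C hRm.aemeasurable (ae_of_all _ hRb)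
  have hrint : Integrable (fun θ => r θ zs) π :=
    .of_mem_Icc 0 C hrm.of_uncurry_right.aemeasurable (ae_of_all _ fun θ => hrb θ zs)
  have hEzs : Integrable (E zs) π₀ :=
    .of_mem_Icc _ _ hEm.of_uncurry_left.aemeasurable (ae_of_all _ (hEb zs))
  have hdv := integral_le_integral_llr_add_log_integral_exp hac
    ((hRint.sub hrint).const_mul lam) hEzs hllr
  have hlog : Real.log (∫ θ, E zs θ ∂π₀) ≤ lam ^ 2 * C ^ 2 / (8 * n) + Real.log (1 / δ) := by
    refine (Real.log_le_log (integral_exp_pos hEzs) (le_of_lt hzs)).trans_eq ?_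
    rw [div_eq_mul_one_div, Real.log_mul (Real.exp_pos _).ne' (one_div_pos.2 hδ0).ne',
      Real.log_exp]
  rw [KL, if_pos ⟨hac, hllr⟩, ← EReal.coe_add, ← EReal.coe_add, ← EReal.coe_div,
    ← EReal.coe_add, EReal.coe_le_coe_iff]
  change ∫ θ, R θ ∂π ≤ ∫ θ, r θ zs ∂π + _ + (∫ θ, llr π π₀ θ ∂π + _) / lam
  simp only [Pi.sub_apply] at hdv
  rw [integral_const_mul, integral_sub hRint hrint] at hdv
  have hgap : ∫ θ, R θ ∂π - ∫ θ, r θ zs ∂π ≤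
      (∫ θ, llr π π₀ θ ∂π + (lam ^ 2 * C ^ 2 / (8 * n) + Real.log (1 / δ))) / lam :=
    (le_div_iff₀' hlam).2 (hdv.trans (add_le_add_right hlog _))
  have hsplit : (∫ θ, llr π π₀ θ ∂π + (lam ^ 2 * C ^ 2 / (8 * n) + Real.log (1 / δ))) / lam =
      lam * C ^ 2 / (8 * n) + (∫ θ, llr π π₀ θ ∂π + Real.log (1 / δ)) / lam := by
    field_simp
    ring
  linarith
end

section
/- Let Θ be a measurable space, π₀ a probability measure on Θ, and h : Θ → ℝ a bounded measurable function. Then log ∫ e^h dπ₀ = sup over all probability measures π on Θ absolutely continuous with respect to π₀ with KL(π ‖ π₀) < ∞ of ( ∫ h dπ − KL(π ‖ π₀) ), and the supremum is attained by the tilted measure with π₀-density e^h / ∫ e^h dπ₀. -/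
open MeasureTheory Classical

/-- The exponentially tilted measure with `π₀`-density `e^h / ∫ e^h dπ₀`. -/
noncomputable def tilted {Θ : Type*} [MeasurableSpace Θ] (π₀ : Measure Θ)
    (h : Θ → ℝ) : Measure Θ :=
  π₀.withDensity fun θ =>
    ENNReal.ofReal (Real.exp (h θ) / ∫ θ', Real.exp (h θ') ∂π₀)

lemma KL_eq_integral_llr {Θ : Type*} [MeasurableSpace Θ] {π π₀ : Measure Θ}
    (hac : π ≪ π₀) (hint : Integrable (llr π π₀) π) :
    KL π π₀ = ((∫ θ, llr π π₀ θ ∂π : ℝ) : EReal) :=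
  if_pos ⟨hac, hint⟩

lemma integrable_llr_of_KL_ne_top {Θ : Type*} [MeasurableSpace Θ] {π π₀ : Measure Θ}
    (hKL : KL π π₀ ≠ ⊤) : Integrable (llr π π₀) π := by
  by_contra hint
  exact hKL (if_neg fun hcond => hint hcond.2)

lemma tilted_eq_measure_tilted {Θ : Type*} [MeasurableSpace Θ] (π₀ : Measure Θ) (h : Θ → ℝ) :
    tilted π₀ h = π₀.tilted h := rfl

/-- Gibbs' inequality against the tilted measure. -/
lemma integral_sub_integral_llr_le_log_integral_exp {Θ : Type*} [MeasurableSpace Θ]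
    {π π₀ : Measure Θ} [IsProbabilityMeasure π] [IsProbabilityMeasure π₀] {h : Θ → ℝ}
    (hac : π ≪ π₀) (hllr : Integrable (llr π π₀) π) (hπ : Integrable h π)
    (hexp : Integrable (fun θ => Real.exp (h θ)) π₀) :
    ∫ θ, h θ ∂π - ∫ θ, llr π π₀ θ ∂π ≤ Real.log (∫ θ, Real.exp (h θ) ∂π₀) := by
  have : IsProbabilityMeasure (π₀.tilted h) := isProbabilityMeasure_tilted hexp
  have hnonneg := InformationTheory.integral_llr_add_sub_measure_univ_nonneg
    (hac.trans (absolutelyContinuous_tilted hexp))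
    (integrable_llr_tilted_right hac hπ hllr hexp)
  rw [integral_llr_tilted_right hac hπ hexp hllr] at hnonneg
  simp only [probReal_univ] at hnonneg
  linarith

lemma llr_tilted_self_ae_eq {Θ : Type*} [MeasurableSpace Θ] {π₀ : Measure Θ} [SigmaFinite π₀]
    {h : Θ → ℝ} (hmeas : AEMeasurable h π₀) (hexp : Integrable (fun θ => Real.exp (h θ)) π₀) :
    llr (π₀.tilted h) π₀ =ᵐ[π₀] fun θ => h θ - Real.log (∫ z, Real.exp (h z) ∂π₀) := by
  filter_upwards [llr_tilted_left Measure.AbsolutelyContinuous.rfl hexp hmeas, llr_self π₀]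
    with θ hθ hself
  simp [hθ, hself]

/-- Donsker–Varadhan variational formula: `log ∫ e^h dπ₀` is the supremum of
`∫ h dπ - KL(π ‖ π₀)` over all probability measures `π ≪ π₀` with finite KL divergence,
and the supremum is attained by the tilted measure with `π₀`-density `e^h / ∫ e^h dπ₀`. -/
theorem donsker_varadhan_variational_formula
    {Θ : Type*} [MeasurableSpace Θ]
    (π₀ : Measure Θ) [IsProbabilityMeasure π₀]
    (h : Θ → ℝ) (hmeas : Measurable h) (C : ℝ) (hC : ∀ θ, |h θ| ≤ C) :
    IsGreatest
      {x : ℝ | ∃ π : Measure Θ, IsProbabilityMeasure π ∧ π ≪ π₀ ∧ KL π π₀ ≠ ⊤ ∧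
        x = ∫ θ, h θ ∂π - (KL π π₀).toReal}
      (Real.log (∫ θ, Real.exp (h θ) ∂π₀)) ∧
    IsProbabilityMeasure (tilted π₀ h) ∧ tilted π₀ h ≪ π₀ ∧ KL (tilted π₀ h) π₀ ≠ ⊤ ∧
    ∫ θ, h θ ∂(tilted π₀ h) - (KL (tilted π₀ h) π₀).toReal
      = Real.log (∫ θ, Real.exp (h θ) ∂π₀) := by
  have hbdd (π : Measure Θ) [IsProbabilityMeasure π] : Integrable h π :=
    .of_bound hmeas.aestronglyMeasurable C (.of_forall hC)
  have hexp : Integrable (fun θ => Real.exp (h θ)) π₀ :=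
    .of_bound hmeas.exp.aestronglyMeasurable (Real.exp C) <| .of_forall fun θ => by
      simpa using (le_abs_self _).trans (hC θ)
  have hprob : IsProbabilityMeasure (π₀.tilted h) := isProbabilityMeasure_tilted hexp
  have hac : π₀.tilted h ≪ π₀ := tilted_absolutelyContinuous π₀ h
  have hllr := hac.ae_eq (llr_tilted_self_ae_eq hmeas.aemeasurable hexp)
  have hKL := KL_eq_integral_llr hac
    (((hbdd (π₀.tilted h)).sub (integrable_const _)).congr hllr.symm)
  have hfin : KL (π₀.tilted h) π₀ ≠ ⊤ := hKL ▸ EReal.coe_ne_top _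
  have hattained : ∫ θ, h θ ∂(π₀.tilted h) - (KL (π₀.tilted h) π₀).toReal
      = Real.log (∫ θ, Real.exp (h θ) ∂π₀) := by
    rw [hKL, EReal.toReal_coe, integral_congr_ae hllr,
      integral_sub (hbdd _) (integrable_const _)]
    simp
  rw [tilted_eq_measure_tilted]
  refine ⟨⟨⟨_, hprob, hac, hfin, hattained.symm⟩, ?_⟩, hprob, hac, hfin, hattained⟩
  rintro _ ⟨π, hπ, hπac, hπfin, rfl⟩
  have hπllr := integrable_llr_of_KL_ne_top hπfin
  rw [KL_eq_integral_llr hπac hπllr, EReal.toReal_coe]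
  exact integral_sub_integral_llr_le_log_integral_exp hπac hπllr (hbdd π) hexp
end

section
/- Let (Ω, F, P) be a probability space with a filtration (F_t)_{t=0,…,T}, Θ a measurable space, C > 0, δ ∈ (0,1), and set λ = √(8 log(1/δ)/(T C²)). For t = 1, …, T, let ℓ_t : Θ × Ω → ℝ be jointly measurable with 0 ≤ ℓ_t(θ, ω) ≤ C for all θ, ω, and with ℓ_t(θ, ·) F_t-measurable for each θ. Let (π_t)_{t=1,…,T} be a sequence of probability kernels from Ω to Θ such that π_t is F_{t−1}-measurable. For each t, let L_t : Ω → ℝ be F_t-measurable with 0 ≤ L_t ≤ C, and suppose the λ-mixability inequality holds almost surely: L_t(ω) ≤ −(1/λ) · log ∫ e^{−λ ℓ_t(θ, ω)} dπ_t(ω)(θ). Then with probability at least 1 − δ over P, Σ_{t=1}^{T} E[L_t | F_{t−1}] ≤ Σ_{t=1}^{T} ∫ ℓ_t(θ, ·) dπ_t(θ) + √( T C² log(1/δ) / 2 ). -/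
open MeasureTheory Finset

/-- **Hoeffding's lemma** for a Bernoulli random variable, in scalar form. -/
lemma bernoulli_exp_le (q u : ℝ) (hq : q ∈ Set.Icc (0 : ℝ) 1) :
    (1 - q) + q * Real.exp (-u) ≤ Real.exp (-(u * q) + u ^ 2 / 8) := by
  obtain ⟨h0, h1⟩ := hq
  set μ : Measure ℝ := ENNReal.ofReal (1 - q) • Measure.dirac 0 + ENNReal.ofReal q • Measure.dirac 1
    with hμ
  have hprob : IsProbabilityMeasure μ := by
    constructor
    simp only [hμ, Measure.add_apply, Measure.smul_apply, measure_univ, smul_eq_mul, mul_one]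
    rw [← ENNReal.ofReal_add (by linarith) h0]
    simp
  have hint (f : ℝ → ℝ) : ∫ x, f x ∂μ = (1 - q) * f 0 + q * f 1 := by
    rw [hμ, integral_add_measure, integral_smul_measure, integral_smul_measure]
    · simp [ENNReal.toReal_ofReal, h0, sub_nonneg.2 h1]
    · exact (integrable_dirac (by simp)).smul_measure (by simp)
    · exact (integrable_dirac (by simp)).smul_measure (by simp)
  have hb : ∀ᵐ x ∂μ, x ∈ Set.Icc (0 : ℝ) 1 := by
    rw [hμ, ae_add_measure_iff]
    exact ⟨Measure.ae_smul_measure (by simp [ae_dirac_eq]) _,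
      Measure.ae_smul_measure (by simp [ae_dirac_eq]) _⟩
  have h := (ProbabilityTheory.hasSubgaussianMGF_of_mem_Icc (X := id) aemeasurable_id hb).mgf_le (-u)
  rw [ProbabilityTheory.mgf, hint, hint] at h
  have hc : ((((‖(1 : ℝ) - 0‖₊ / 2) ^ 2 : NNReal)) : ℝ) * (-u) ^ 2 / 2 = u ^ 2 / 8 := by
    simp; ring
  rw [hc] at h
  simp only [id, mul_zero, zero_add, mul_one] at h
  rw [Real.exp_add]
  have e1 : Real.exp (-u * (0 - q)) = Real.exp (u * q) := by congr 1; ring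
  have e2 : Real.exp (-u * (1 - q)) = Real.exp (u * q) * Real.exp (-u) := by
    rw [← Real.exp_add]; congr 1; ring
  rw [e1, e2] at h
  calc (1 - q) + q * Real.exp (-u)
      = Real.exp (-(u * q)) *
          ((1 - q) * Real.exp (u * q) + q * (Real.exp (u * q) * Real.exp (-u))) := by
        rw [Real.exp_neg (u * q)]; field_simp
    _ ≤ _ := by gcongr

/-- The exponential of a bounded variable lies below its chord. -/
lemma exp_neg_mul_le_chord {C lam x : ℝ} (hC : 0 < C) (hx : x ∈ Set.Icc (0 : ℝ) C) :
    Real.exp (-(lam * x)) ≤ 1 - (1 - Real.exp (-(lam * C))) / C * x := by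
  have h := convexOn_exp.2 (Set.mem_univ (0 : ℝ)) (Set.mem_univ (-(lam * C)))
    (sub_nonneg.2 ((div_le_one hC).2 hx.2)) (div_nonneg hx.1 hC.le) (by ring)
  simp only [smul_eq_mul, mul_zero, zero_add, Real.exp_zero, mul_one] at h
  have e : x / C * -(lam * C) = -(lam * x) := by field_simp
  rw [e] at h
  refine h.trans_eq ?_
  ring

/-- The conditional expectation of a variable in `[0, C]` lies in `[0, C]`. -/
lemma condExp_mem_Icc_ae {Ω : Type*} {m F : MeasurableSpace Ω} {P : Measure Ω}
    [IsProbabilityMeasure P] (hm : m ≤ F) {C : ℝ} {X : Ω → ℝ} (hX : Integrable X P)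
    (hXb : ∀ ω, X ω ∈ Set.Icc (0 : ℝ) C) :
    ∀ᵐ ω ∂P, (P[X|m]) ω ∈ Set.Icc (0 : ℝ) C := by
  have h0 := condExp_mono (m := m) (integrable_const (0 : ℝ)) hX (ae_of_all P fun ω => (hXb ω).1)
  have h1 := condExp_mono (m := m) hX (integrable_const C) (ae_of_all P fun ω => (hXb ω).2)
  rw [condExp_const hm] at h0 h1
  filter_upwards [h0, h1] with ω a b using ⟨a, b⟩

/-- Conditional Hoeffding lemma, integrated against a bounded nonnegative weight. -/
lemma integral_mul_exp_condExp_sub_le {Ω : Type*} {m F : MeasurableSpace Ω} {P : Measure Ω}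
    [IsProbabilityMeasure P] (hm : m ≤ F) {C lam K : ℝ} (hC : 0 < C) {X W : Ω → ℝ}
    (hX : Measurable X) (hXb : ∀ ω, X ω ∈ Set.Icc (0 : ℝ) C)
    (hW : StronglyMeasurable[m] W) (hW0 : ∀ ω, 0 ≤ W ω) (hWK : ∀ᵐ ω ∂P, W ω ≤ K) :
    ∫ ω, W ω * Real.exp (lam * ((P[X|m]) ω - X ω)) ∂P
      ≤ Real.exp (lam ^ 2 * C ^ 2 / 8) * ∫ ω, W ω ∂P := by
  have hXi : Integrable X P := Integrable.of_mem_Icc 0 C hX.aemeasurable (ae_of_all P hXb)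
  set p : Ω → ℝ := P[X|m] with hp
  have hpm : StronglyMeasurable[m] p := stronglyMeasurable_condExp
  have hpb : ∀ᵐ ω ∂P, p ω ∈ Set.Icc (0 : ℝ) C := condExp_mem_Icc_ae hm hXi hXb
  set a := (1 - Real.exp (-(lam * C))) / C with ha
  set U : Ω → ℝ := fun ω => W ω * Real.exp (lam * p ω) with hU
  have hUm : StronglyMeasurable[m] U :=
    hW.mul (Real.continuous_exp.comp_stronglyMeasurable (hpm.const_mul lam))
  have hUb : ∀ᵐ ω ∂P, ‖U ω‖ ≤ K * Real.exp (|lam| * C) := by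
    filter_upwards [hWK, hpb] with ω hw hb
    rw [Real.norm_of_nonneg (mul_nonneg (hW0 ω) (Real.exp_pos _).le)]
    refine mul_le_mul hw (Real.exp_le_exp.2 ?_) (Real.exp_pos _).le ((hW0 ω).trans hw)
    exact mul_le_mul (le_abs_self lam) hb.2 hb.1 (abs_nonneg _)
  have hUi : Integrable U P := .of_bound (hUm.mono hm).aestronglyMeasurable _ hUb
  have hUX : Integrable (U * X) P := hXi.bdd_mul (hUm.mono hm).aestronglyMeasurable hUb
  have hUp : Integrable (U * p) P :=
    integrable_condExp.bdd_mul (hUm.mono hm).aestronglyMeasurable hUb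
  have hWi : Integrable W P := by
    refine .of_bound (hW.mono hm).aestronglyMeasurable K ?_
    filter_upwards [hWK] with ω hw
    rwa [Real.norm_of_nonneg (hW0 ω)]
  have hpull : ∫ ω, (U * X) ω ∂P = ∫ ω, (U * p) ω ∂P := by
    rw [← integral_condExp hm]
    exact integral_congr_ae (condExp_mul_of_stronglyMeasurable_left hUm hUX hXi)
  calc ∫ ω, W ω * Real.exp (lam * (p ω - X ω)) ∂P
      ≤ ∫ ω, (U ω - a * (U * X) ω) ∂P := by
        refine integral_mono_of_nonneg (ae_of_all P fun ω => mul_nonneg (hW0 ω) (Real.exp_pos _).le)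
          (hUi.sub (hUX.const_mul a)) (ae_of_all P fun ω => ?_)
        have h := mul_le_mul_of_nonneg_left (exp_neg_mul_le_chord (lam := lam) hC (hXb ω))
          (mul_nonneg (hW0 ω) (Real.exp_pos (lam * p ω)).le)
        rw [mul_assoc, ← Real.exp_add] at h
        have e : lam * (p ω - X ω) = lam * p ω + -(lam * X ω) := by ring
        simp only [e, Pi.mul_apply, hU]
        refine h.trans_eq ?_
        ring
    _ = ∫ ω, (U ω - a * (U * p) ω) ∂P := by
        rw [integral_sub hUi (hUX.const_mul a), integral_sub hUi (hUp.const_mul a),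
          integral_const_mul, integral_const_mul, hpull]
    _ ≤ ∫ ω, Real.exp (lam ^ 2 * C ^ 2 / 8) * W ω ∂P := by
        refine integral_mono_ae (hUi.sub (hUp.const_mul a)) (hWi.const_mul _) ?_
        filter_upwards [hpb] with ω hb
        have h := bernoulli_exp_le (p ω / C) (lam * C)
          ⟨div_nonneg hb.1 hC.le, (div_le_one hC).2 hb.2⟩
        have e : -(lam * C * (p ω / C)) + (lam * C) ^ 2 / 8
            = -(lam * p ω) + lam ^ 2 * C ^ 2 / 8 := by field_simp
        rw [e] at h
        have h' := mul_le_mul_of_nonneg_left h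
          (mul_nonneg (hW0 ω) (Real.exp_pos (lam * p ω)).le)
        rw [mul_assoc (W ω) _ (Real.exp _), ← Real.exp_add, add_neg_cancel_left] at h'
        simp only [Pi.mul_apply, hU]
        refine (Eq.le ?_).trans (h'.trans_eq (mul_comm _ _))
        rw [ha]
        ring
    _ = _ := integral_const_mul _ _

/-- Azuma–Hoeffding bound on the moment generating function of the sum of the compensated
differences of an adapted sequence with values in `[0, C]`. -/
lemma integrable_and_integral_exp_sum_condExp_sub_le {Ω : Type*} {F : MeasurableSpace Ω}
    (P : Measure Ω) [IsProbabilityMeasure P] (𝓕 : Filtration ℕ F) (T : ℕ) {C lam : ℝ} (hC : 0 < C)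
    (hlam : 0 ≤ lam) (L : ℕ → Ω → ℝ) (hLmeas : ∀ t ∈ Icc 1 T, Measurable[𝓕 t] (L t))
    (hLbound : ∀ t ∈ Icc 1 T, ∀ ω, L t ω ∈ Set.Icc (0 : ℝ) C) :
    Integrable (fun ω => Real.exp (lam * ∑ t ∈ Icc 1 T, ((P[L t|𝓕 (t - 1)]) ω - L t ω))) P ∧
    ∫ ω, Real.exp (lam * ∑ t ∈ Icc 1 T, ((P[L t|𝓕 (t - 1)]) ω - L t ω)) ∂P
      ≤ Real.exp (T * (lam ^ 2 * C ^ 2 / 8)) := by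
  set W : ℕ → Ω → ℝ := fun n ω =>
    Real.exp (lam * ∑ t ∈ Icc 1 n, ((P[L t|𝓕 (t - 1)]) ω - L t ω)) with hWdef
  have hWm : ∀ n ≤ T, StronglyMeasurable[𝓕 n] (W n) := by
    intro n hn
    refine Real.continuous_exp.comp_stronglyMeasurable (.const_mul ?_ lam)
    refine Finset.stronglyMeasurable_fun_sum _ fun t ht => ?_
    rw [mem_Icc] at ht
    exact (stronglyMeasurable_condExp.mono (𝓕.mono (by omega))).sub
      ((hLmeas t (mem_Icc.2 ⟨ht.1, ht.2.trans hn⟩)).stronglyMeasurable.mono (𝓕.mono ht.2))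
  have hLm : ∀ t ∈ Icc 1 T, Measurable (L t) := fun t ht => (hLmeas t ht).mono (𝓕.le t) le_rfl
  have hWb : ∀ n ≤ T, ∀ᵐ ω ∂P, W n ω ≤ Real.exp (lam * (n * C)) := by
    intro n hn
    have hall : ∀ᵐ ω ∂P, ∀ t ∈ Icc 1 n, (P[L t|𝓕 (t - 1)]) ω ∈ Set.Icc (0 : ℝ) C := by
      rw [Finset.eventually_all]
      intro t ht
      have ht' := Icc_subset_Icc_right hn ht
      exact condExp_mem_Icc_ae (𝓕.le _)
        (Integrable.of_mem_Icc 0 C (hLm t ht').aemeasurable (ae_of_all P (hLbound t ht')))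
        (hLbound t ht')
    filter_upwards [hall] with ω h
    refine Real.exp_le_exp.2 (mul_le_mul_of_nonneg_left ?_ hlam)
    have := Finset.sum_le_card_nsmul (Icc 1 n)
      (fun t => (P[L t|𝓕 (t - 1)]) ω - L t ω) C fun t ht => by
        have := (h t ht).2
        have := (hLbound t (Icc_subset_Icc_right hn ht) ω).1
        linarith
    simpa using this
  have key : ∀ n ≤ T, ∫ ω, W n ω ∂P ≤ Real.exp (n * (lam ^ 2 * C ^ 2 / 8)) := by
    intro n
    induction n with
    | zero => intro _; simp [hWdef]
    | succ n ih =>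
      intro hn
      have hmem : n + 1 ∈ Icc 1 T := mem_Icc.2 ⟨by omega, hn⟩
      have h := integral_mul_exp_condExp_sub_le (P := P) (𝓕.le n) (lam := lam) hC (hLm _ hmem)
        (hLbound _ hmem) (hWm n (by omega)) (fun ω => (Real.exp_pos _).le) (hWb n (by omega))
      have e : W (n + 1) = fun ω =>
          W n ω * Real.exp (lam * ((P[L (n + 1)|𝓕 n]) ω - L (n + 1) ω)) := by
        funext ω
        simp only [hWdef]
        rw [sum_Icc_succ_top (by omega), mul_add, Real.exp_add, Nat.add_sub_cancel]
      rw [e]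
      refine h.trans ((mul_le_mul_of_nonneg_left (ih (by omega)) (Real.exp_pos _).le).trans_eq ?_)
      rw [← Real.exp_add]
      push_cast
      ring_nf
  refine ⟨.of_bound ((hWm T le_rfl).mono (𝓕.le T)).aestronglyMeasurable
    (Real.exp (lam * (T * C))) ?_, key T le_rfl⟩
  filter_upwards [hWb T le_rfl] with ω h
  rwa [Real.norm_of_nonneg (Real.exp_pos _).le]

/-- By Jensen's inequality, the mix loss is at most the expected loss. -/
lemma neg_log_integral_exp_le_integral {Θ : Type*} [MeasurableSpace Θ] (μ : Measure Θ)
    [IsProbabilityMeasure μ] {C lam : ℝ} (hlam : 0 < lam) {f : Θ → ℝ} (hf : Measurable f)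
    (hfb : ∀ θ, f θ ∈ Set.Icc (0 : ℝ) C) :
    -(1 / lam) * Real.log (∫ θ, Real.exp (-(lam * f θ)) ∂μ) ≤ ∫ θ, f θ ∂μ := by
  have hfi : Integrable f μ := Integrable.of_mem_Icc 0 C hf.aemeasurable (ae_of_all μ hfb)
  have hei : Integrable (fun θ => Real.exp (-(lam * f θ))) μ := by
    refine .of_bound (by fun_prop) 1 (ae_of_all μ fun θ => ?_)
    rw [Real.norm_of_nonneg (Real.exp_pos _).le, Real.exp_le_one_iff, neg_nonpos]
    exact mul_nonneg hlam.le (hfb θ).1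
  have h := convexOn_exp.map_integral_le (μ := μ) (f := fun θ => -(lam * f θ))
    Real.continuous_exp.continuousOn isClosed_univ (by simp) (hfi.const_mul lam).neg hei
  rw [integral_neg, integral_const_mul] at h
  have h2 := (Real.le_log_iff_exp_le ((Real.exp_pos _).trans_le h)).2 h
  have h3 := mul_le_mul_of_nonneg_left h2 (one_div_pos.2 hlam).le
  have e : 1 / lam * -(lam * ∫ θ, f θ ∂μ) = -∫ θ, f θ ∂μ := by field_simp
  rw [e] at h3
  linarith

/-- Corollary 3 of the paper: under the `λ`-mixability assumption with
`λ = √(8 log(1/δ)/(T C²))`, the aggregated predictor inherits the O(√T) online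
PAC-Bayes regret bound of the Gibbs stochastic predictor: with probability at least
`1 - δ`, `Σ_t E[L_t | F_{t-1}] ≤ Σ_t ∫ ℓ_t(θ,·) dπ_t(θ) + √(T C² log(1/δ)/2)`. -/
theorem aggregated_predictor_sqrtT_regret
    {Ω Θ : Type*} {F : MeasurableSpace Ω} [MeasurableSpace Θ]
    (P : Measure Ω) [IsProbabilityMeasure P]
    (𝓕 : Filtration ℕ F)
    (T : ℕ) (C : ℝ) (hC : 0 < C)
    (δ : ℝ) (hδ : δ ∈ Set.Ioo (0 : ℝ) 1)
    (lam : ℝ) (hlam : lam = Real.sqrt (8 * Real.log (1 / δ) / (T * C ^ 2)))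
    (ℓ : ℕ → Θ → Ω → ℝ)
    (hℓmeas : ∀ t ∈ Icc 1 T, Measurable (Function.uncurry (ℓ t)))
    (hℓbound : ∀ t ∈ Icc 1 T, ∀ θ ω, ℓ t θ ω ∈ Set.Icc (0 : ℝ) C)
    (hℓadapted : ∀ t ∈ Icc 1 T, ∀ θ, Measurable[𝓕 t] (ℓ t θ))
    (pri : ℕ → Ω → Measure Θ)
    (hpri_prob : ∀ t ∈ Icc 1 T, ∀ ω, IsProbabilityMeasure (pri t ω))
    (hpri_meas : ∀ t ∈ Icc 1 T, ∀ s : Set Θ, MeasurableSet s →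
      Measurable[𝓕 (t - 1)] fun ω => pri t ω s)
    (L : ℕ → Ω → ℝ)
    (hLmeas : ∀ t ∈ Icc 1 T, Measurable[𝓕 t] (L t))
    (hLbound : ∀ t ∈ Icc 1 T, ∀ ω, L t ω ∈ Set.Icc (0 : ℝ) C)
    (hmix : ∀ t ∈ Icc 1 T, ∀ᵐ ω ∂P,
      L t ω ≤ -(1 / lam) * Real.log (∫ θ, Real.exp (-(lam * ℓ t θ ω)) ∂(pri t ω))) :
    ENNReal.ofReal (1 - δ) ≤
      P {ω | ∑ t ∈ Icc 1 T, (P[L t|𝓕 (t - 1)]) ω ≤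
            (∑ t ∈ Icc 1 T, ∫ θ, ℓ t θ ω ∂(pri t ω))
              + Real.sqrt (T * C ^ 2 * Real.log (1 / δ) / 2)} := by
  obtain ⟨hδ0, hδ1⟩ := hδ
  rcases Nat.eq_zero_or_pos T with rfl | hT
  · simp only [zero_lt_one, Icc_eq_empty_of_lt, sum_empty, zero_add, Real.sqrt_nonneg,
      Set.ofPred_true, measure_univ]
    exact ENNReal.ofReal_le_one.2 (by linarith)
  have hT' : (0 : ℝ) < T := Nat.cast_pos.2 hT
  set l := Real.log (1 / δ) with hl
  have hl0 : 0 < l := Real.log_pos (by rw [one_div]; exact (one_lt_inv₀ hδ0).2 hδ1)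
  have hlam0 : 0 < lam := by rw [hlam]; positivity
  set a := Real.sqrt (T * C ^ 2 * l / 2) with ha
  have hsq : lam ^ 2 = 8 * l / (T * C ^ 2) := by rw [hlam, Real.sq_sqrt (by positivity)]
  have hla : lam * a = 2 * l := by
    rw [hlam, ha, ← Real.sqrt_mul (by positivity)]
    have e : 8 * l / (T * C ^ 2) * (T * C ^ 2 * l / 2) = (2 * l) ^ 2 := by field_simp; ring
    rw [e, Real.sqrt_sq (by positivity)]
  obtain ⟨hint, hle⟩ := integrable_and_integral_exp_sum_condExp_sub_le P 𝓕 T hC hlam0.le L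
    hLmeas hLbound
  set D : Ω → ℝ := fun ω => ∑ t ∈ Icc 1 T, ((P[L t|𝓕 (t - 1)]) ω - L t ω) with hD
  have hbad : P.real {ω | a ≤ D ω} ≤ δ := by
    refine (ProbabilityTheory.measure_ge_le_exp_mul_mgf a hlam0.le hint).trans
      ((mul_le_mul_of_nonneg_left hle (Real.exp_pos _).le).trans_eq ?_)
    have e : -lam * a + T * (lam ^ 2 * C ^ 2 / 8) = -l := by
      rw [neg_mul, hla, hsq]; field_simp; ring
    rw [← Real.exp_add, e, hl, one_div, Real.log_inv, neg_neg, Real.exp_log hδ0]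
  have hgood : ∀ᵐ ω ∂P, ∀ t ∈ Icc 1 T, L t ω ≤ ∫ θ, ℓ t θ ω ∂(pri t ω) := by
    rw [Finset.eventually_all]
    intro t ht
    filter_upwards [hmix t ht] with ω h
    have := hpri_prob t ht ω
    exact h.trans (neg_log_integral_exp_le_integral (pri t ω) hlam0
      ((hℓmeas t ht).comp measurable_prodMk_right) fun θ => hℓbound t ht θ ω)
  calc ENNReal.ofReal (1 - δ) ≤ P {ω | a ≤ D ω}ᶜ := by
        rw [ENNReal.ofReal_sub _ hδ0.le, ENNReal.ofReal_one, tsub_le_iff_left,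
          ← measure_univ (μ := P)]
        refine (measure_univ_le_add_compl {ω | a ≤ D ω}).trans ?_
        gcongr
        exact (ENNReal.le_ofReal_iff_toReal_le (measure_ne_top _ _) hδ0.le).2 hbad
    _ ≤ _ := by
        refine measure_mono_ae ?_
        filter_upwards [hgood] with ω hg hω
        have h1 : D ω < a := not_le.1 hω
        have h2 := sum_le_sum hg
        rw [hD] at h1
        simp only [sum_sub_distrib] at h1
        change _ ≤ _
        linarith
end
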